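/- Let k be a field of characteristic zero. For any polynomials P,Q ∈ k[x₁,x₂,x₃,x₄], the Jacobian bracket {f,g} := {f,g}_{P,Q} satisfies the Jacobi identity: for all f,g,h ∈ k[x₁,x₂,x₃,x₄], {f,{g,h}} + {g,{h,f}} + {h,{f,g}} = 0. In particular, for quadrics Q₁,Q₂ cutting out a normal elliptic curve E ⊂ P³, the quadratic bracket {ℓ₁,ℓ₂} = dℓ₁∧dℓ₂∧dQ₁∧dQ₂/vol inducing the Feigin–Odesskii bracket Π_E is a Poisson bracket. -/

import Mathlib

open MvPolynomial

noncomputable section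

/-- The Jacobian bracket `{f,g}_{P,Q}`: the determinant of the 4×4 matrix whose
columns are the gradients ∇f, ∇g, ∇P, ∇Q. -/
def jacBracket {k : Type*} [Field k] (P Q f g : MvPolynomial (Fin 4) k) :
    MvPolynomial (Fin 4) k :=
  Matrix.det (Matrix.of fun i j => pderiv i (![f, g, P, Q] j))

open Matrix

section Cross

variable {R : Type*} [CommRing R]

/-- The cross product of three vectors in `R⁴`: pairing it with `d` gives the determinant of the
matrix with columns `a`, `b`, `c`, `d`. -/
def tripleCross (a b c : Fin 4 → R) : Fin 4 → R :=
  ![-(a 1 * (b 2 * c 3 - b 3 * c 2) - a 2 * (b 1 * c 3 - b 3 * c 1)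
      + a 3 * (b 1 * c 2 - b 2 * c 1)),
    a 0 * (b 2 * c 3 - b 3 * c 2) - a 2 * (b 0 * c 3 - b 3 * c 0)
      + a 3 * (b 0 * c 2 - b 2 * c 0),
    -(a 0 * (b 1 * c 3 - b 3 * c 1) - a 1 * (b 0 * c 3 - b 3 * c 0)
      + a 3 * (b 0 * c 1 - b 1 * c 0)),
    a 0 * (b 1 * c 2 - b 2 * c 1) - a 1 * (b 0 * c 2 - b 2 * c 0)
      + a 2 * (b 0 * c 1 - b 1 * c 0)]

theorem tripleCross_swap_left (a b c : Fin 4 → R) :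
    tripleCross b a c = -tripleCross a b c := by
  ext i; fin_cases i <;> simp [tripleCross] <;> ring

theorem tripleCross_dotProduct_rotate (a b c d : Fin 4 → R) :
    tripleCross a b c ⬝ᵥ d = -(tripleCross b c d ⬝ᵥ a) := by
  simp [tripleCross, dotProduct, Fin.sum_univ_four]; ring

theorem tripleCross_dotProduct_swap (a b c d : Fin 4 → R) :
    tripleCross a b c ⬝ᵥ d = -(tripleCross a b d ⬝ᵥ c) := by
  simp [tripleCross, dotProduct, Fin.sum_univ_four]; ring

theorem Matrix.IsSymm.dotProduct_mulVec_comm {n : Type*} [Fintype n] {S : Matrix n n R}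
    (hS : S.IsSymm) (u v : n → R) : u ⬝ᵥ S *ᵥ v = v ⬝ᵥ S *ᵥ u := by
  rw [dotProduct_mulVec, ← mulVec_transpose, hS.eq, dotProduct_comm]

/-- The cyclic sum of `tripleCross q b c ⊗ tripleCross p q a` is alternating. -/
theorem tripleCross_cyclic_symm (p q a b c : Fin 4 → R) {S : Matrix (Fin 4) (Fin 4) R}
    (hS : S.IsSymm) :
    tripleCross q b c ⬝ᵥ S *ᵥ tripleCross p q a + tripleCross q c a ⬝ᵥ S *ᵥ tripleCross p q b +
      tripleCross q a b ⬝ᵥ S *ᵥ tripleCross p q c = 0 := by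
  simp only [dotProduct, mulVec, Fin.sum_univ_four, hS.apply 0 1, hS.apply 0 2, hS.apply 0 3,
    hS.apply 1 2, hS.apply 1 3, hS.apply 2 3]
  simp only [tripleCross, cons_val]
  ring

theorem Derivation.tripleCross_dotProduct {k : Type*} [CommRing k] [Algebra k R]
    (δ : Derivation k R R) (a b c d : Fin 4 → R) :
    δ (tripleCross a b c ⬝ᵥ d) =
      tripleCross (δ ∘ a) b c ⬝ᵥ d + tripleCross a (δ ∘ b) c ⬝ᵥ d +
      tripleCross a b (δ ∘ c) ⬝ᵥ d + tripleCross a b c ⬝ᵥ (δ ∘ d) := by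
  simp only [dotProduct, Fin.sum_univ_four, tripleCross, cons_val, map_add, map_sub, map_neg,
    Derivation.leibniz, smul_eq_mul, Function.comp_apply]
  ring

end Cross

section Gradient

variable {k : Type*} [Field k]

theorem pderiv_pderiv_comm {σ : Type*} (i j : σ) (p : MvPolynomial σ k) :
    pderiv i (pderiv j p) = pderiv j (pderiv i p) := by
  have h : ⁅pderiv (R := k) i, pderiv (R := k) j⁆ = 0 := by
    classical
    ext l
    simp [Derivation.commutator_apply, pderiv_X, Pi.single_apply, apply_ite]
  have := congrArg (fun D => D p) h
  simpa [Derivation.commutator_apply, sub_eq_zero] using this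

/-- The gradient of a polynomial. -/
def grad (f : MvPolynomial (Fin 4) k) : Fin 4 → MvPolynomial (Fin 4) k := fun i => pderiv i f

/-- The Hessian matrix of a polynomial. -/
def hessian (f : MvPolynomial (Fin 4) k) : Matrix (Fin 4) (Fin 4) (MvPolynomial (Fin 4) k) :=
  .of fun i j => pderiv j (pderiv i f)

theorem hessian_isSymm (f : MvPolynomial (Fin 4) k) : (hessian f).IsSymm :=
  Matrix.ext fun _ _ => pderiv_pderiv_comm _ _ f

theorem jacBracket_eq_dotProduct (P Q f g : MvPolynomial (Fin 4) k) :
    jacBracket P Q f g = tripleCross (grad P) (grad Q) (grad f) ⬝ᵥ grad g := by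
  simp [jacBracket, grad, tripleCross, dotProduct, det_succ_row_zero,
    Fin.sum_univ_succ, Fin.succAbove]
  ring

/-- The derivation along a vector field. -/
def derivAlong (v : Fin 4 → MvPolynomial (Fin 4) k) :
    Derivation k (MvPolynomial (Fin 4) k) (MvPolynomial (Fin 4) k) :=
  ∑ i, v i • pderiv i

theorem derivAlong_apply (v : Fin 4 → MvPolynomial (Fin 4) k) (f : MvPolynomial (Fin 4) k) :
    derivAlong v f = v ⬝ᵥ grad f := by
  simp [derivAlong, dotProduct, grad, Fin.sum_univ_four]

theorem derivAlong_comp_grad (v : Fin 4 → MvPolynomial (Fin 4) k) (f : MvPolynomial (Fin 4) k) :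
    derivAlong v ∘ grad f = hessian f *ᵥ v := by
  ext1 i
  rw [Function.comp_apply, derivAlong_apply, dotProduct_comm]
  rfl

/-- Differentiating `{g,h}` along the Hamiltonian vector field of `f`. -/
theorem jacBracket_jacBracket (P Q f g h : MvPolynomial (Fin 4) k) :
    jacBracket P Q f (jacBracket P Q g h) =
      -(tripleCross (grad Q) (grad g) (grad h) ⬝ᵥ
          hessian P *ᵥ tripleCross (grad P) (grad Q) (grad f)) +
      tripleCross (grad P) (grad g) (grad h) ⬝ᵥ
          hessian Q *ᵥ tripleCross (grad P) (grad Q) (grad f) -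
      tripleCross (grad P) (grad Q) (grad h) ⬝ᵥ
          hessian g *ᵥ tripleCross (grad P) (grad Q) (grad f) +
      tripleCross (grad P) (grad Q) (grad g) ⬝ᵥ
          hessian h *ᵥ tripleCross (grad P) (grad Q) (grad f) := by
  rw [jacBracket_eq_dotProduct P Q f, ← derivAlong_apply, jacBracket_eq_dotProduct,
    Derivation.tripleCross_dotProduct]
  simp only [derivAlong_comp_grad]
  rw [tripleCross_dotProduct_rotate (hessian P *ᵥ _), tripleCross_swap_left (hessian Q *ᵥ _),
    neg_dotProduct, tripleCross_dotProduct_rotate (hessian Q *ᵥ _),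
    tripleCross_dotProduct_swap _ _ (hessian g *ᵥ _)]
  ring

end Gradient

/-- For any polynomials `P, Q`, the Jacobian bracket `{f,g}_{P,Q}` satisfies the
Jacobi identity; in particular the quadratic bracket inducing the Feigin–Odesskii
bracket `Π_E` of a normal elliptic curve `E ⊂ P³` is a Poisson bracket. -/
theorem jacBracket_jacobi {k : Type*} [Field k] [CharZero k]
    (P Q : MvPolynomial (Fin 4) k) :
    ∀ f g h : MvPolynomial (Fin 4) k,
      jacBracket P Q f (jacBracket P Q g h) +
        jacBracket P Q g (jacBracket P Q h f) +
        jacBracket P Q h (jacBracket P Q f g) = 0 := by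
  intro f g h
  have hP := tripleCross_cyclic_symm (grad P) (grad Q) (grad f) (grad g) (grad h)
    (hessian_isSymm P)
  have hQ := tripleCross_cyclic_symm (grad Q) (grad P) (grad f) (grad g) (grad h)
    (hessian_isSymm Q)
  simp only [tripleCross_swap_left (grad P) (grad Q), mulVec_neg, dotProduct_neg] at hQ
  have hf := (hessian_isSymm f).dotProduct_mulVec_comm
    (tripleCross (grad P) (grad Q) (grad g)) (tripleCross (grad P) (grad Q) (grad h))
  have hg := (hessian_isSymm g).dotProduct_mulVec_comm
    (tripleCross (grad P) (grad Q) (grad h)) (tripleCross (grad P) (grad Q) (grad f))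
  have hh := (hessian_isSymm h).dotProduct_mulVec_comm
    (tripleCross (grad P) (grad Q) (grad f)) (tripleCross (grad P) (grad Q) (grad g))
  simp only [jacBracket_jacBracket]
  linear_combination -hP - hQ - hf - hg - hh
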